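/- arXiv:2210.14549 — 3 statements merged into one kernel-verified Lean document; each statement's English description precedes it below -/
import Mathlib

section
/- Let C be a binary linear [n,k] code with generator matrix G (rows r₁,…,r_k) and parity check matrix H (rows s₁,…,s_{n−k}, a generator matrix of C⊥). Let x ∈ GF(2)^n satisfy x·x = 0, set y_i = x·r_i and z_j = x·s_j. Let G₃ be the (k+1)×(n+2) matrix with first row (1, 0, x₁, …, x_n) and (i+1)-st row (y_i, y_i, r_i), generating the code C₃, and let H₃ be the (n−k+1)×(n+2) matrix with first row (0, 1, x₁, …, x_n) and (j+1)-st row (z_j, z_j, s_j). Then H₃ is a parity check matrix for C₃, i.e., the row space of H₃ equals C₃⊥. -/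
open Matrix

/-- The dual code of a binary linear code `C ⊆ GF(2)^n`. -/
def dualCode {n : ℕ} (C : Submodule (ZMod 2) (Fin n → ZMod 2)) :
    Submodule (ZMod 2) (Fin n → ZMod 2) where
  carrier := {v | ∀ c ∈ C, v ⬝ᵥ c = 0}
  add_mem' := by
    intro a b ha hb c hc
    simp only [Set.mem_setOf_eq] at *
    rw [add_dotProduct, ha c hc, hb c hc, add_zero]
  zero_mem' := by
    intro c hc
    simp
  smul_mem' := by
    intro a v hv c hc
    simp only [Set.mem_setOf_eq] at *
    rw [smul_dotProduct, hv c hc, smul_zero]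

/-- The hull of a binary linear code: `Hull(C) = C ∩ C⊥`. -/
def hull {n : ℕ} (C : Submodule (ZMod 2) (Fin n → ZMod 2)) :
    Submodule (ZMod 2) (Fin n → ZMod 2) := C ⊓ dualCode C

/-- The linear map `u ↦ (x ⬝ᵥ u, x ⬝ᵥ u, u)`. -/
def prependDotTwice {n : ℕ} (x : Fin n → ZMod 2) :
    (Fin n → ZMod 2) →ₗ[ZMod 2] (Fin (n + 2) → ZMod 2) where
  toFun u := Fin.cons (x ⬝ᵥ u) (Fin.cons (x ⬝ᵥ u) u)
  map_add' u v := by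
    funext i
    refine Fin.cases ?_ (fun i => Fin.cases ?_ (fun i => ?_) i) i <;> simp [dotProduct_add]
  map_smul' a u := by
    funext i
    refine Fin.cases ?_ (fun i => Fin.cases ?_ (fun i => ?_) i) i <;> simp [dotProduct_smul]

theorem prependDotTwice_apply {n : ℕ} (x u : Fin n → ZMod 2) :
    prependDotTwice x u = Fin.cons (x ⬝ᵥ u) (Fin.cons (x ⬝ᵥ u) u) := rfl

theorem mem_dualCode {n : ℕ} {C : Submodule (ZMod 2) (Fin n → ZMod 2)} {v : Fin n → ZMod 2} :
    v ∈ dualCode C ↔ ∀ c ∈ C, v ⬝ᵥ c = 0 := Iff.rfl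

theorem mem_dualCode_span {n : ℕ} {S : Set (Fin n → ZMod 2)} {v : Fin n → ZMod 2} :
    v ∈ dualCode (Submodule.span (ZMod 2) S) ↔ ∀ c ∈ S, v ⬝ᵥ c = 0 := by
  refine ⟨fun h c hc => h c (Submodule.subset_span hc), fun h c hc => ?_⟩
  induction hc using Submodule.span_induction with
  | mem c hc => exact h c hc
  | zero => simp
  | add c d _ _ hc hd => rw [dotProduct_add, hc, hd, add_zero]
  | smul a c _ hc => rw [dotProduct_smul, hc, smul_zero]

theorem cons_cons_dotProduct_cons_cons {n : ℕ} (a b c d : ZMod 2) (u v : Fin n → ZMod 2) :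
    (Fin.cons a (Fin.cons b u) : Fin (n + 2) → ZMod 2) ⬝ᵥ Fin.cons c (Fin.cons d v) =
      a * c + (b * d + u ⬝ᵥ v) := by
  simp [dotProduct, Fin.sum_univ_succ]

theorem range_cons_prependDotTwice {m n : ℕ} (x : Fin n → ZMod 2) (g : Fin (n + 2) → ZMod 2)
    (A : Matrix (Fin m) (Fin n) (ZMod 2)) :
    (Set.range fun i => Matrix.of (Fin.cons g
      (fun i => Fin.cons (x ⬝ᵥ A i) (Fin.cons (x ⬝ᵥ A i) (A i))) :
        Fin (m + 1) → Fin (n + 2) → ZMod 2) i) =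
      insert g (prependDotTwice x '' Set.range fun i => A i) := by
  rw [← Set.range_comp]
  exact Fin.range_cons g (prependDotTwice x ∘ fun i => A i)

/-- The dual of the code obtained from a spanning set `S` of `C` by Construction IV. -/
theorem mem_dualCode_constructionIV {n : ℕ} {S : Set (Fin n → ZMod 2)} (x : Fin n → ZMod 2)
    (hx : x ⬝ᵥ x = 0) (v : Fin (n + 2) → ZMod 2) :
    v ∈ dualCode (Submodule.span (ZMod 2)
        (insert (Fin.cons 1 (Fin.cons 0 x)) (prependDotTwice x '' S))) ↔
      ∃ a : ZMod 2, ∃ u ∈ dualCode (Submodule.span (ZMod 2) S),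
        v = a • Fin.cons 0 (Fin.cons 1 x) + prependDotTwice x u := by
  simp only [mem_dualCode_span, Set.forall_mem_insert, Set.forall_mem_image]
  constructor
  · induction v using Fin.consCases with | _ a w =>
    induction w using Fin.consCases with | _ b w =>
    simp only [prependDotTwice_apply, cons_cons_dotProduct_cons_cons]
    rintro ⟨h₀, h⟩
    have hw : x ⬝ᵥ w = a := by
      rw [dotProduct_comm]
      grind
    have hu : x ⬝ᵥ (w + (a + b) • x) = a := by simp [dotProduct_add, dotProduct_smul, hx, hw]
    refine ⟨a + b, w + (a + b) • x, fun c hc => ?_, ?_⟩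
    · rw [add_dotProduct, smul_dotProduct, smul_eq_mul]
      linear_combination h hc
    · rw [hu]
      funext i
      refine Fin.cases ?_ (fun i => Fin.cases ?_ (fun i => ?_) i) i
      · simp
      · simp
        grind
      · simp
        grind
  · rintro ⟨a, u, hu, rfl⟩
    simp only [add_dotProduct, smul_dotProduct, prependDotTwice_apply,
      cons_cons_dotProduct_cons_cons, smul_eq_mul]
    refine ⟨?_, fun c hc => ?_⟩
    · rw [hx, dotProduct_comm u x]
      grind
    · rw [hu c hc]
      grind

/-- For Construction IV applied to a binary `[n,k]` code `C` with
generator matrix `G`, parity check matrix `H`, and `x` with `x ⬝ᵥ x = 0`, the matrix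
`H₃` with first row `(0,1,x)` and rows `(z_j, z_j, s_j)` is a parity check matrix for
the code `C₃` generated by `G₃`, i.e. the row space of `H₃` equals `C₃⊥`. -/
theorem constructionIV_parityCheck {n k : ℕ}
    (G : Matrix (Fin k) (Fin n) (ZMod 2))
    (hG : LinearIndependent (ZMod 2) (fun i => G i))
    (H : Matrix (Fin (n - k)) (Fin n) (ZMod 2))
    (hH : LinearIndependent (ZMod 2) (fun j => H j))
    (C : Submodule (ZMod 2) (Fin n → ZMod 2))
    (hC : C = Submodule.span (ZMod 2) (Set.range fun i => G i))
    (hHdual : Submodule.span (ZMod 2) (Set.range fun j => H j) = dualCode C)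
    (x : Fin n → ZMod 2) (hx : x ⬝ᵥ x = 0)
    (G₃ : Matrix (Fin (k + 1)) (Fin (n + 2)) (ZMod 2))
    (hG₃ : G₃ = Matrix.of (Fin.cons (Fin.cons 1 (Fin.cons 0 x))
      (fun i => Fin.cons (x ⬝ᵥ G i) (Fin.cons (x ⬝ᵥ G i) (G i)))))
    (C₃ : Submodule (ZMod 2) (Fin (n + 2) → ZMod 2))
    (hC₃ : C₃ = Submodule.span (ZMod 2) (Set.range fun i => G₃ i))
    (H₃ : Matrix (Fin (n - k + 1)) (Fin (n + 2)) (ZMod 2))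
    (hH₃ : H₃ = Matrix.of (Fin.cons (Fin.cons 0 (Fin.cons 1 x))
      (fun j => Fin.cons (x ⬝ᵥ H j) (Fin.cons (x ⬝ᵥ H j) (H j))))) :
    Submodule.span (ZMod 2) (Set.range fun j => H₃ j) = dualCode C₃ := by
  subst hC hG₃ hC₃ hH₃
  refine (congrArg (Submodule.span (ZMod 2)) (range_cons_prependDotTwice x _ H)).trans (Eq.trans ?_
    (congrArg (fun S => dualCode (Submodule.span (ZMod 2) S))
      (range_cons_prependDotTwice x _ G)).symm)
  ext v
  rw [mem_dualCode_constructionIV x hx, Submodule.mem_span_insert, ← hHdual,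
    Submodule.span_image]
  simp only [Submodule.mem_map, exists_exists_and_eq_and]
end

section
/- Let C be a nonzero binary linear [n,k] code with generator matrix G (rows r₁,…,r_k), let x ∈ GF(2)^n satisfy x·x = 1, set y_i = x·r_i, and let C₁ be the code generated by the (k+1)×(n+2) matrix G₁ with first row (1, 0, x₁, …, x_n) and (i+1)-st rows (y_i, y_i, r_i). Then min{d(C), weight(x + C) + 1} ≤ d(C₁) ≤ ρ(C) + 2, where weight(x + C) = min_{c∈C} wt(x + c) and ρ(C) is the covering radius of C. -/
open Matrix

/-- The minimum distance of a binary linear code: the smallest Hamming weight of a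
nonzero codeword. -/
noncomputable def minDist {n : ℕ} (C : Submodule (ZMod 2) (Fin n → ZMod 2)) : ℕ :=
  sInf {w | ∃ c ∈ C, c ≠ 0 ∧ hammingNorm c = w}

/-- The minimum weight of the coset `x + C`: `weight(x + C) = min_{c ∈ C} wt(x + c)`. -/
noncomputable def cosetWeight {n : ℕ} (x : Fin n → ZMod 2)
    (C : Submodule (ZMod 2) (Fin n → ZMod 2)) : ℕ :=
  sInf {w | ∃ c ∈ C, hammingNorm (x + c) = w}

/-- The covering radius of a binary code: `ρ(C) = max_{v} min_{c ∈ C} d_H(v, c)`. -/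
noncomputable def coveringRadius {n : ℕ} (C : Submodule (ZMod 2) (Fin n → ZMod 2)) : ℕ :=
  sSup {r | ∃ v : Fin n → ZMod 2, r = sInf {w | ∃ c ∈ C, hammingDist v c = w}}

theorem hammingNorm_cons {n : ℕ} (a : ZMod 2) (v : Fin n → ZMod 2) :
    hammingNorm (Fin.cons a v : Fin (n + 1) → ZMod 2) =
      (if a ≠ 0 then 1 else 0) + hammingNorm v := by
  simp only [hammingNorm, Finset.card_filter, Fin.sum_univ_succ, Fin.cons_zero, Fin.cons_succ]

/-- The linear embedding `c ↦ (x ⬝ᵥ c, x ⬝ᵥ c, c)`. -/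
def dotExtension {n : ℕ} (x : Fin n → ZMod 2) :
    (Fin n → ZMod 2) →ₗ[ZMod 2] (Fin (n + 2) → ZMod 2) where
  toFun c := Fin.cons (x ⬝ᵥ c) (Fin.cons (x ⬝ᵥ c) c)
  map_add' a b := by
    ext i
    refine Fin.cases ?_ (fun i => Fin.cases ?_ (fun i => ?_) i) i <;> simp [dotProduct_add]
  map_smul' r a := by
    ext i
    refine Fin.cases ?_ (fun i => Fin.cases ?_ (fun i => ?_) i) i <;> simp [dotProduct_smul]

theorem hammingNorm_le_hammingNorm_dotExtension {n : ℕ} (x c : Fin n → ZMod 2) :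
    hammingNorm c ≤ hammingNorm (dotExtension x c) := by
  change _ ≤ hammingNorm (Fin.cons (x ⬝ᵥ c) (Fin.cons (x ⬝ᵥ c) c) : Fin (n + 2) → ZMod 2)
  rw [hammingNorm_cons, hammingNorm_cons]
  lia

theorem hammingNorm_cons_add_dotExtension {n : ℕ} (x c : Fin n → ZMod 2) :
    hammingNorm ((Fin.cons 1 (Fin.cons 0 x) : Fin (n + 2) → ZMod 2) + dotExtension x c) =
      hammingNorm (x + c) + 1 := by
  have h : (Fin.cons 1 (Fin.cons 0 x) : Fin (n + 2) → ZMod 2) + dotExtension x c =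
      Fin.cons (1 + x ⬝ᵥ c) (Fin.cons (x ⬝ᵥ c) (x + c)) := by
    ext i
    refine Fin.cases ?_ (fun i => Fin.cases ?_ (fun i => ?_) i) i <;> simp [dotExtension]
  have key : ∀ y : ZMod 2, (if 1 + y ≠ 0 then 1 else 0) + (if y ≠ 0 then 1 else 0) = 1 := by
    decide
  rw [h, hammingNorm_cons, hammingNorm_cons, ← add_assoc, key, add_comm]

theorem mem_span_constructionI {n k : ℕ} (G : Matrix (Fin k) (Fin n) (ZMod 2))
    (x : Fin n → ZMod 2) (v : Fin (n + 2) → ZMod 2) :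
    v ∈ Submodule.span (ZMod 2) (Set.range fun i =>
        (Matrix.of (Fin.cons (Fin.cons 1 (Fin.cons 0 x))
          (fun i => Fin.cons (x ⬝ᵥ G i) (Fin.cons (x ⬝ᵥ G i) (G i)))) :
            Matrix (Fin (k + 1)) (Fin (n + 2)) (ZMod 2)) i) ↔
      ∃ a : ZMod 2, ∃ c ∈ Submodule.span (ZMod 2) (Set.range fun i => G i),
        v = a • (Fin.cons 1 (Fin.cons 0 x) : Fin (n + 2) → ZMod 2) + dotExtension x c := by
  have h : (Set.range fun i =>
        (Matrix.of (Fin.cons (Fin.cons 1 (Fin.cons 0 x))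
          (fun i => Fin.cons (x ⬝ᵥ G i) (Fin.cons (x ⬝ᵥ G i) (G i)))) :
            Matrix (Fin (k + 1)) (Fin (n + 2)) (ZMod 2)) i) =
      insert (Fin.cons 1 (Fin.cons 0 x) : Fin (n + 2) → ZMod 2)
        (dotExtension x '' Set.range fun i => G i) := by
    rw [← Set.range_comp]
    exact Fin.range_cons _ _
  rw [h, Submodule.mem_span_insert, ← Submodule.map_span]
  simp only [Submodule.mem_map, exists_exists_and_eq_and]

theorem cosetWeight_le_coveringRadius {n : ℕ} (x : Fin n → ZMod 2)
    (C : Submodule (ZMod 2) (Fin n → ZMod 2)) : cosetWeight x C ≤ coveringRadius C := by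
  refine le_csSup ⟨n, ?_⟩ ⟨x, ?_⟩
  · rintro r ⟨v, rfl⟩
    have h : sInf {w | ∃ c ∈ C, hammingDist v c = w} ≤ hammingDist v 0 :=
      Nat.sInf_le ⟨0, C.zero_mem, rfl⟩
    exact h.trans (by simpa using hammingDist_le_card_fintype (x := v) (y := 0))
  · simp only [cosetWeight, hammingDist_eq_hammingNorm, ZModModule.neg_eq_self]

theorem exists_hammingNorm_add_eq_cosetWeight {n : ℕ} (x : Fin n → ZMod 2)
    (C : Submodule (ZMod 2) (Fin n → ZMod 2)) :
    ∃ c ∈ C, hammingNorm (x + c) = cosetWeight x C :=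
  Nat.sInf_mem (s := {w | ∃ c ∈ C, hammingNorm (x + c) = w}) ⟨_, 0, C.zero_mem, rfl⟩

/-- For Construction I (with `x ⬝ᵥ x = 1`) applied to a nonzero binary
`[n,k]` code `C`, one has
`min (d(C)) (weight(x + C) + 1) ≤ d(C₁) ≤ ρ(C) + 2`. -/
theorem constructionI_minDist_bounds {n k : ℕ}
    (G : Matrix (Fin k) (Fin n) (ZMod 2))
    (hG : LinearIndependent (ZMod 2) (fun i => G i))
    (C : Submodule (ZMod 2) (Fin n → ZMod 2)) (hCne : C ≠ ⊥)
    (hC : C = Submodule.span (ZMod 2) (Set.range fun i => G i))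
    (x : Fin n → ZMod 2) (hx : x ⬝ᵥ x = 1)
    (G₁ : Matrix (Fin (k + 1)) (Fin (n + 2)) (ZMod 2))
    (hG₁ : G₁ = Matrix.of (Fin.cons (Fin.cons 1 (Fin.cons 0 x))
      (fun i => Fin.cons (x ⬝ᵥ G i) (Fin.cons (x ⬝ᵥ G i) (G i)))))
    (C₁ : Submodule (ZMod 2) (Fin (n + 2) → ZMod 2))
    (hC₁ : C₁ = Submodule.span (ZMod 2) (Set.range fun i => G₁ i)) :
    min (minDist C) (cosetWeight x C + 1) ≤ minDist C₁ ∧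
      minDist C₁ ≤ coveringRadius C + 2 := by
  subst hC hG₁ hC₁
  obtain ⟨c₀, hc₀, hw⟩ := exists_hammingNorm_add_eq_cosetWeight x
    (Submodule.span (ZMod 2) (Set.range fun i => G i))
  have hnorm := hammingNorm_cons_add_dotExtension x c₀
  have hmem := (mem_span_constructionI G x _).2 ⟨1, c₀, hc₀, rfl⟩
  rw [one_smul] at hmem
  have hne : (Fin.cons 1 (Fin.cons 0 x) : Fin (n + 2) → ZMod 2) + dotExtension x c₀ ≠ 0 := by
    rw [← hammingNorm_ne_zero_iff]
    lia
  constructor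
  · refine le_csInf ⟨_, _, hmem, hne, rfl⟩ ?_
    rintro _ ⟨v, hv, hv0, rfl⟩
    obtain ⟨a, c, hc, rfl⟩ := (mem_span_constructionI G x v).1 hv
    obtain rfl | rfl : a = 0 ∨ a = 1 := by
      clear hv hv0
      revert a
      decide
    · rw [zero_smul, zero_add] at hv0 ⊢
      have hc0 : c ≠ 0 := fun h => hv0 (by rw [h, map_zero])
      have hd : minDist (Submodule.span (ZMod 2) (Set.range fun i => G i)) ≤ hammingNorm c :=
        Nat.sInf_le ⟨c, hc, hc0, rfl⟩
      exact (min_le_left _ _).trans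
        (hd.trans (hammingNorm_le_hammingNorm_dotExtension x c))
    · rw [one_smul, hammingNorm_cons_add_dotExtension]
      exact (min_le_right _ _).trans (Nat.succ_le_succ (Nat.sInf_le ⟨c, hc, rfl⟩))
  · refine le_trans (b := hammingNorm (x + c₀) + 1) (Nat.sInf_le ⟨_, hmem, hne, hnorm⟩) ?_
    rw [hw]
    have := cosetWeight_le_coveringRadius x (Submodule.span (ZMod 2) (Set.range fun i => G i))
    lia
end

section
/- Let C be the binary code of length 13 spanned by the rows of the 7×13 matrix over GF(2): [[1,0,0,0,0,0,0,0,1,0,1,0,1],[0,1,1,1,1,0,0,0,0,0,0,0,0],[0,0,0,1,1,1,1,0,0,0,0,0,0],[0,0,0,0,0,1,1,1,1,0,0,0,0],[0,0,0,0,0,0,0,1,1,1,1,0,0],[0,0,0,0,0,0,0,0,0,1,1,1,1],[0,0,1,0,1,0,1,0,1,0,1,0,1]] (obtained by augmenting the coset leader (0,0,0,0,0,0,0,1,0,1,0,1) of the self-dual [12,6,4] code B₁₂ with a new coordinate). Then C is a [13, 7, 4] binary linear code (dimension 7, minimum Hamming weight of a nonzero codeword equal to 4), and the dimension of Hull(C)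 is 5. -/
open Matrix

/-- The codewords of the row space of a matrix are the combinations of its rows. -/
theorem mem_span_rows_iff {m n : ℕ} (M : Matrix (Fin m) (Fin n) (ZMod 2)) (c : Fin n → ZMod 2) :
    c ∈ Submodule.span (ZMod 2) (Set.range fun i => M i) ↔ ∃ v, v ᵥ* M = c := by
  change c ∈ Submodule.span (ZMod 2) (Set.range M.row) ↔ _
  rw [← range_vecMulLinear]
  rfl

/-- If only the trivial combination of the rows of `M` vanishes, the row space has dimension the
number of rows. -/
theorem finrank_span_rows {m n : ℕ} (M : Matrix (Fin m) (Fin n) (ZMod 2))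
    (h : ∀ v, v ᵥ* M = 0 → v = 0) :
    Module.finrank (ZMod 2) (Submodule.span (ZMod 2) (Set.range fun i => M i)) = m := by
  have hinj : Function.Injective M.vecMulLinear := (injective_iff_map_eq_zero _).2 h
  have hli : LinearIndependent (ZMod 2) M.row := Matrix.vecMul_injective_iff.1 hinj
  exact (finrank_span_eq_card hli).trans (Fintype.card_fin m)

/-- A vector lies in the dual of the row space of `M` iff it is orthogonal to every row. -/
theorem mem_dualCode_span_rows_iff {m n : ℕ} (M : Matrix (Fin m) (Fin n) (ZMod 2))
    (x : Fin n → ZMod 2) :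
    x ∈ dualCode (Submodule.span (ZMod 2) (Set.range fun i => M i)) ↔ ∀ i, x ⬝ᵥ M i = 0 := by
  refine ⟨fun h i => h _ (Submodule.subset_span ⟨i, rfl⟩), fun h c hc => ?_⟩
  obtain ⟨v, rfl⟩ := (mem_span_rows_iff M c).1 hc
  have hx : M *ᵥ x = 0 := by
    ext i
    simpa [Matrix.mulVec, dotProduct_comm] using h i
  rw [dotProduct_comm, ← Matrix.dotProduct_mulVec, hx, dotProduct_zero]

/-- The generator matrix of the code. -/
def generatorMatrix : Matrix (Fin 7) (Fin 13) (ZMod 2) :=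
  !![1,0,0,0,0,0,0,0,1,0,1,0,1;
     0,1,1,1,1,0,0,0,0,0,0,0,0;
     0,0,0,1,1,1,1,0,0,0,0,0,0;
     0,0,0,0,0,1,1,1,1,0,0,0,0;
     0,0,0,0,0,0,0,1,1,1,1,0,0;
     0,0,0,0,0,0,0,0,0,1,1,1,1;
     0,0,1,0,1,0,1,0,1,0,1,0,1]

/-- A generator matrix of the hull: the rows of `generatorMatrix` indexed `1`, `2`, `4`, `5`,
and the sum of the rows indexed `3` and `6`. -/
def hullMatrix : Matrix (Fin 5) (Fin 13) (ZMod 2) :=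
  !![0,1,1,1,1,0,0,0,0,0,0,0,0;
     0,0,0,1,1,1,1,0,0,0,0,0,0;
     0,0,1,0,1,1,0,1,0,0,1,0,1;
     0,0,0,0,0,0,0,1,1,1,1,0,0;
     0,0,0,0,0,0,0,0,0,1,1,1,1]

theorem hull_span_generatorMatrix :
    hull (Submodule.span (ZMod 2) (Set.range fun i => generatorMatrix i)) =
      Submodule.span (ZMod 2) (Set.range fun i => hullMatrix i) := by
  apply le_antisymm
  · rintro c ⟨hc, hd⟩
    obtain ⟨v, rfl⟩ := (mem_span_rows_iff _ c).1 hc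
    replace hd := (mem_dualCode_span_rows_iff _ _).1 hd
    have key : ∀ v : Fin 7 → ZMod 2, (∀ i, (v ᵥ* generatorMatrix) ⬝ᵥ generatorMatrix i = 0) →
        ![v 1, v 2, v 3, v 4, v 5] ᵥ* hullMatrix = v ᵥ* generatorMatrix := by
      decide +kernel
    exact (mem_span_rows_iff _ _).2 ⟨_, key v hd⟩
  · rw [Submodule.span_le]
    rintro _ ⟨i, rfl⟩
    refine ⟨(mem_span_rows_iff _ _).2 ?_, (mem_dualCode_span_rows_iff _ _).2 ?_⟩
    · revert i
      decide +kernel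
    · revert i
      decide +kernel

/-- The binary code `C` of length 13 spanned by the rows of the given
`7 × 13` matrix (obtained by augmenting a coset leader of the self-dual `[12,6,4]`
code `B₁₂` with a new coordinate) is a `[13, 7, 4]` code (dimension 7; every nonzero
codeword has Hamming weight at least 4 and some nonzero codeword has weight exactly
4), and its hull has dimension 5. -/
theorem code_13_7_4_hull5
    (M : Matrix (Fin 7) (Fin 13) (ZMod 2))
    (hM : M = !![1,0,0,0,0,0,0,0,1,0,1,0,1;
                 0,1,1,1,1,0,0,0,0,0,0,0,0;
                 0,0,0,1,1,1,1,0,0,0,0,0,0;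
                 0,0,0,0,0,1,1,1,1,0,0,0,0;
                 0,0,0,0,0,0,0,1,1,1,1,0,0;
                 0,0,0,0,0,0,0,0,0,1,1,1,1;
                 0,0,1,0,1,0,1,0,1,0,1,0,1])
    (C : Submodule (ZMod 2) (Fin 13 → ZMod 2))
    (hC : C = Submodule.span (ZMod 2) (Set.range fun i => M i)) :
    Module.finrank (ZMod 2) ↥C = 7 ∧
      (∀ c ∈ C, c ≠ 0 → 4 ≤ hammingNorm c) ∧
      (∃ c ∈ C, c ≠ 0 ∧ hammingNorm c = 4) ∧
      Module.finrank (ZMod 2) ↥(hull C) = 5 := by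
  change M = generatorMatrix at hM
  subst hM hC
  refine ⟨finrank_span_rows _ (by decide +kernel), fun c hc hc0 => ?_, ?_, ?_⟩
  · obtain ⟨v, rfl⟩ := (mem_span_rows_iff _ c).1 hc
    have key : ∀ v : Fin 7 → ZMod 2, v ᵥ* generatorMatrix ≠ 0 →
        4 ≤ hammingNorm (v ᵥ* generatorMatrix) := by
      decide +kernel
    exact key v hc0
  · exact ⟨generatorMatrix 0, Submodule.subset_span ⟨0, rfl⟩, by decide +kernel,
      by decide +kernel⟩
  · rw [hull_span_generatorMatrix]
    exact finrank_span_rows _ (by decide +kernel)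
end
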